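/- arXiv:1703.00781 — 2 statements merged into one kernel-verified Lean document; each statement's English description precedes it below -/
import Mathlib

section
/- Let k ≥ 2 be an integer, let α ∈ (1 − 1/k, 1), and let g : ℝ → ℂ be a measurable function for which there exists a constant C > 0 with |g(x)| ≤ C/(1 + |x|) for all x ∈ ℝ. Then ∫_{ℝ^k} |g(x₁ + … + x_k)|² · |x₁|^{−α} ⋯ |x_k|^{−α} dx₁ … dx_k < ∞. -/
open MeasureTheory Filter Set
open scoped ENNReal

/-- The Riesz-type weight `|x|^(-a)` on the line, with values in `ℝ≥0∞`. -/
noncomputable def rieszWeight (a x : ℝ) : ℝ≥0∞ := ENNReal.ofReal (|x| ^ (-a))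

@[fun_prop]
theorem measurable_rieszWeight (a : ℝ) : Measurable (rieszWeight a) := by
  unfold rieszWeight
  fun_prop

theorem rieszWeight_mul (a x y : ℝ) :
    rieszWeight a (x * y) = rieszWeight a x * rieszWeight a y := by
  rw [rieszWeight, abs_mul, Real.mul_rpow (abs_nonneg x) (abs_nonneg y),
    ENNReal.ofReal_mul (by positivity)]
  rfl

theorem integrable_abs_rpow_mul_one_add_abs_rpow {a b : ℝ} (ha : a < 1) (hb : 0 ≤ b)
    (hab : 1 < a + b) : Integrable (fun x : ℝ => |x| ^ (-a) * (1 + |x|) ^ (-b)) := by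
  have h := integrable_fun_norm_addHaar (volume : Measure ℝ)
    (f := fun t : ℝ => t ^ (-a) * (1 + t) ^ (-b))
  simp only [Real.norm_eq_abs, Module.finrank_self, le_refl, tsub_eq_zero_of_le, pow_zero,
    one_smul] at h
  rw [h, ← Ioc_union_Ioi_eq_Ioi zero_le_one, integrableOn_union]
  constructor
  · have h₁ : IntegrableOn (fun t : ℝ => t ^ (-a)) (Ioc 0 1) :=
      (intervalIntegrable_iff_integrableOn_Ioc_of_le zero_le_one).1
        (intervalIntegral.intervalIntegrable_rpow' (by linarith))
    refine Integrable.mono' h₁ (by fun_prop) ?_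
    filter_upwards [ae_restrict_mem measurableSet_Ioc] with t ht
    have ht0 : 0 < t := ht.1
    rw [Real.norm_of_nonneg (by positivity)]
    exact mul_le_of_le_one_right (by positivity)
      (Real.rpow_le_one_of_one_le_of_nonpos (by linarith) (neg_nonpos.2 hb))
  · have h₁ : IntegrableOn (fun t : ℝ => t ^ (-a + -b)) (Ioi 1) :=
      integrableOn_Ioi_rpow_of_lt (by linarith) zero_lt_one
    refine Integrable.mono' h₁ (by fun_prop) ?_
    filter_upwards [ae_restrict_mem measurableSet_Ioi] with t ht
    have ht0 : 0 < t := zero_lt_one.trans ht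
    rw [Real.norm_of_nonneg (by positivity), Real.rpow_add ht0]
    exact mul_le_mul_of_nonneg_left
      (Real.rpow_le_rpow_of_nonpos ht0 (by linarith) (by linarith)) (by positivity)

theorem abs_rpow_mul_abs_sub_rpow_le {a b : ℝ} (hb : 0 ≤ b) {t s : ℝ}
    (hts : t + s = 1) (h : |t| ≤ |s|) :
    |t| ^ (-a) * |s| ^ (-b) ≤ 3 ^ b * (|t| ^ (-a) * (1 + |t|) ^ (-b)) := by
  have h₁ : 1 ≤ |t| + |s| := by simpa [hts] using abs_add_le t s
  have h₂ : |s| ^ (-b) ≤ ((1 + |t|) / 3) ^ (-b) :=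
    Real.rpow_le_rpow_of_nonpos (by positivity) (by linarith) (by linarith)
  rw [Real.div_rpow (by positivity) (by norm_num), Real.rpow_neg (by norm_num : (0 : ℝ) ≤ 3),
    div_inv_eq_mul] at h₂
  calc |t| ^ (-a) * |s| ^ (-b) ≤ |t| ^ (-a) * ((1 + |t|) ^ (-b) * 3 ^ b) := by gcongr
    _ = _ := by ring

theorem lintegral_rieszWeight_mul_rieszWeight_one_sub_lt_top {a b : ℝ} (ha : a ∈ Ioo 0 1)
    (hb : b ∈ Ioo 0 1) (hab : 1 < a + b) :
    ∫⁻ t, rieszWeight a t * rieszWeight b (1 - t) < ⊤ := by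
  have h₁ := (integrable_abs_rpow_mul_one_add_abs_rpow ha.2 hb.1.le hab).const_mul (3 ^ b)
  have h₂ := ((integrable_abs_rpow_mul_one_add_abs_rpow hb.2 ha.1.le
    (by linarith)).const_mul (3 ^ a)).comp_sub_left 1
  refine lt_of_le_of_lt (lintegral_mono fun t => ?_) (h₁.add h₂).lintegral_lt_top
  rw [rieszWeight, rieszWeight, ← ENNReal.ofReal_mul (by positivity)]
  refine ENNReal.ofReal_le_ofReal ?_
  simp only [Pi.add_apply]
  rcases le_total |t| |1 - t| with h | h
  · exact (abs_rpow_mul_abs_sub_rpow_le hb.1.le (by ring) h).trans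
      (le_add_of_nonneg_right (by positivity))
  · rw [mul_comm]
    exact (abs_rpow_mul_abs_sub_rpow_le ha.1.le (by ring) h).trans
      (le_add_of_nonneg_left (by positivity))

theorem lintegral_rieszWeight_mul_rieszWeight_sub (a b : ℝ) {y : ℝ} (hy : y ≠ 0) :
    ∫⁻ x, rieszWeight a x * rieszWeight b (y - x) =
      (∫⁻ t, rieszWeight a t * rieszWeight b (1 - t)) * rieszWeight (a + b - 1) y := by
  have hy' : 0 < |y| := abs_pos.2 hy
  have hw : ENNReal.ofReal |y| * (rieszWeight a y * rieszWeight b y) =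
      rieszWeight (a + b - 1) y := by
    simp only [rieszWeight]
    rw [← ENNReal.ofReal_mul (by positivity), ← ENNReal.ofReal_mul (by positivity),
      ← Real.rpow_add hy', show -(a + b - 1) = 1 + (-a + -b) by ring, Real.rpow_add hy' 1,
      Real.rpow_one]
  have hs : ∀ t, rieszWeight a (y * t) * rieszWeight b (y - y * t) =
      (rieszWeight a y * rieszWeight b y) * (rieszWeight a t * rieszWeight b (1 - t)) := by
    intro t
    rw [show y - y * t = y * (1 - t) by ring, rieszWeight_mul, rieszWeight_mul]
    ring
  conv_lhs => rw [← Real.smul_map_volume_mul_left hy]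
  rw [lintegral_smul_measure, lintegral_map (by fun_prop) (by fun_prop), ← hw]
  simp_rw [hs]
  rw [lintegral_const_mul _ (by fun_prop), smul_eq_mul]
  ring

/-- Integrating a function of `x₀ + ⋯ + xₙ` against the product of the weights `|xᵢ|^(-α)` is
controlled by integrating it against a single weight on the line. -/
theorem exists_lintegral_sum_mul_prod_rieszWeight_le {α : ℝ} (hα : α ∈ Ioo 0 1) (n : ℕ)
    (hn : 0 < 1 - (n + 1) * (1 - α)) :
    ∃ c : ℝ≥0∞, c < ⊤ ∧ ∀ h : ℝ → ℝ≥0∞, Measurable h →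
      ∫⁻ x : Fin (n + 1) → ℝ, h (∑ i, x i) * ∏ i, rieszWeight α (x i) ≤
        c * ∫⁻ y, h y * rieszWeight (1 - (n + 1) * (1 - α)) y := by
  induction n with
  | zero =>
    refine ⟨1, ENNReal.one_lt_top, fun h hh => ?_⟩
    have he : ∫⁻ x : Fin 1 → ℝ, h (x 0) * rieszWeight α (x 0) = ∫⁻ y, h y * rieszWeight α y := by
      convert (volume_preserving_funUnique (Fin 1) ℝ).lintegral_comp_emb
        (MeasurableEquiv.measurableEmbedding _) (fun y => h y * rieszWeight α y) <;> rfl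
    simpa using he.le
  | succ n ih =>
    push_cast at hn
    set β : ℝ := 1 - (n + 1) * (1 - α) with hβ
    have hβ' : 1 - ((n + 1 : ℕ) + 1) * (1 - α) = α + β - 1 := by push_cast; ring
    have hβ0 : 0 < β := by nlinarith [hα.2]
    have hβ1 : β < 1 := by nlinarith [hα.2, (Nat.cast_nonneg n : (0 : ℝ) ≤ n)]
    obtain ⟨c, hc, hch⟩ := ih hβ0
    refine ⟨c * ∫⁻ t, rieszWeight α t * rieszWeight β (1 - t), ENNReal.mul_lt_top hc
      (lintegral_rieszWeight_mul_rieszWeight_one_sub_lt_top hα ⟨hβ0, hβ1⟩ (by linarith)),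
      fun h hh => ?_⟩
    have he := (volume_preserving_piFinSuccAbove (fun _ : Fin (n + 2) => ℝ) 0).lintegral_comp_emb
      (MeasurableEquiv.measurableEmbedding _) (fun p : ℝ × (Fin (n + 1) → ℝ) =>
        rieszWeight α p.1 * (h (p.1 + ∑ i, p.2 i) * ∏ i, rieszWeight α (p.2 i)))
    calc ∫⁻ x : Fin (n + 2) → ℝ, h (∑ i, x i) * ∏ i, rieszWeight α (x i)
        = ∫⁻ p : ℝ × (Fin (n + 1) → ℝ),
            rieszWeight α p.1 * (h (p.1 + ∑ i, p.2 i) * ∏ i, rieszWeight α (p.2 i)) := by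
          rw [← he]
          refine lintegral_congr fun x => ?_
          rw [Fin.sum_univ_succ, Fin.prod_univ_succ, mul_left_comm]
          rfl
      _ = ∫⁻ x₀, rieszWeight α x₀ *
            ∫⁻ x : Fin (n + 1) → ℝ, h (x₀ + ∑ i, x i) * ∏ i, rieszWeight α (x i) := by
          rw [Measure.volume_eq_prod, lintegral_prod _ (by fun_prop)]
          refine lintegral_congr fun x₀ => ?_
          dsimp only
          rw [lintegral_const_mul]
          fun_prop
      _ ≤ ∫⁻ x₀, rieszWeight α x₀ * (c * ∫⁻ y, h y * rieszWeight β (y - x₀)) := by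
          refine lintegral_mono fun x₀ => mul_le_mul_right ?_ _
          refine (hch (fun y => h (x₀ + y)) (by fun_prop)).trans_eq ?_
          rw [← lintegral_add_left_eq_self (fun y => h y * rieszWeight β (y - x₀)) x₀]
          simp only [add_sub_cancel_left]
      _ = ∫⁻ x₀, c * ∫⁻ y, h y * (rieszWeight α x₀ * rieszWeight β (y - x₀)) := by
          refine lintegral_congr fun x₀ => ?_
          simp_rw [mul_left_comm (h _)]
          rw [lintegral_const_mul _ (by fun_prop), mul_left_comm]
      _ = c * ∫⁻ y, h y * ∫⁻ x₀, rieszWeight α x₀ * rieszWeight β (y - x₀) := by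
          rw [lintegral_const_mul' _ _ hc.ne, lintegral_lintegral_swap (by fun_prop)]
          congr 1
          exact lintegral_congr fun y => lintegral_const_mul _ (by fun_prop)
      _ = _ := by
          rw [hβ', mul_assoc]
          congr 1
          rw [← lintegral_const_mul _ (by fun_prop)]
          refine lintegral_congr_ae ?_
          filter_upwards [Measure.ae_ne volume (0 : ℝ)] with y hy
          rw [lintegral_rieszWeight_mul_rieszWeight_sub α β hy, mul_left_comm]

theorem stmt6 (k : ℕ) (hk : 2 ≤ k) (α : ℝ) (hα : α ∈ Set.Ioo (1 - 1 / (k : ℝ)) 1)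
    (g : ℝ → ℂ) (hg : Measurable g) (C : ℝ) (hC : 0 < C)
    (hgb : ∀ x : ℝ, ‖g x‖ ≤ C / (1 + |x|)) :
    ∫⁻ x : Fin k → ℝ,
      ENNReal.ofReal (‖g (∑ i, x i)‖ ^ 2 * ∏ i, |x i| ^ (-α)) < ⊤ := by
  obtain ⟨n, rfl⟩ : ∃ n, k = n + 1 := ⟨k - 1, by omega⟩
  have hn : (1 : ℝ) ≤ n := by exact_mod_cast (by omega : 1 ≤ n)
  have hn0 : (0 : ℝ) < n + 1 := by positivity
  obtain ⟨hα₁, hα₂⟩ := hα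
  push_cast at hα₁
  have hβ0 : 0 < 1 - (n + 1) * (1 - α) := by
    have := (lt_div_iff₀ hn0).1 (by linarith : 1 - α < 1 / (n + 1))
    linarith
  have hα0 : 0 < α := by nlinarith
  obtain ⟨c, hc, hch⟩ := exists_lintegral_sum_mul_prod_rieszWeight_le ⟨hα0, hα₂⟩ n hβ0
  set β : ℝ := 1 - (n + 1) * (1 - α) with hβ
  have hβ1 : β < 1 := by nlinarith
  have hint := (integrable_abs_rpow_mul_one_add_abs_rpow hβ1 zero_le_two
    (by linarith)).const_mul (C ^ 2)
  have hprod : ∀ x : Fin (n + 1) → ℝ,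
      ENNReal.ofReal (‖g (∑ i, x i)‖ ^ 2 * ∏ i, |x i| ^ (-α)) =
        ENNReal.ofReal (‖g (∑ i, x i)‖ ^ 2) * ∏ i, rieszWeight α (x i) := by
    intro x
    rw [ENNReal.ofReal_mul (by positivity), ENNReal.ofReal_prod_of_nonneg
      fun i _ => by positivity]
    rfl
  simp_rw [hprod]
  refine (hch (fun y => ENNReal.ofReal (‖g y‖ ^ 2)) (by fun_prop)).trans_lt
    (ENNReal.mul_lt_top hc (lt_of_le_of_lt (lintegral_mono fun y => ?_) hint.lintegral_lt_top))
  rw [rieszWeight, ← ENNReal.ofReal_mul (by positivity)]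
  refine ENNReal.ofReal_le_ofReal ?_
  have hsq : ‖g y‖ ^ 2 ≤ C ^ 2 * (1 + |y|) ^ (-2 : ℝ) := by
    rw [Real.rpow_neg (by positivity), Real.rpow_two, ← div_eq_mul_inv, ← div_pow]
    exact pow_le_pow_left₀ (norm_nonneg _) (hgb y) 2
  calc ‖g y‖ ^ 2 * |y| ^ (-β) ≤ (C ^ 2 * (1 + |y|) ^ (-2 : ℝ)) * |y| ^ (-β) := by gcongr
    _ = _ := by ring
end

section
/- Let k ≥ 2 be an integer, α ∈ (1 − 1/k, 1), ψ ∈ 𝒜, and f ∈ 𝓕. Then lim_{ε→0⁺} ∫_{ℝ^k} |ψ̂(x₁ + … + x_k)|² · |f̂(ε(x₁ + … + x_k)) − 1|² · |x₁|^{−α} ⋯ |x_k|^{−α} dx₁ … dx_k = 0. -/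
open MeasureTheory Filter Set
open scoped ENNReal

/-- The class `𝒜` of finite linear combinations of indicators of bounded intervals. -/
def memA (ψ : ℝ → ℝ) : Prop :=
  ∃ (m : ℕ) (a : Fin m → ℝ) (I : Fin m → Set ℝ),
    (∀ j, (I j).OrdConnected ∧ Bornology.IsBounded (I j)) ∧
    ∀ x, ψ x = ∑ j, a j * (I j).indicator (fun _ => (1 : ℝ)) x

/-- The class `𝓕`: nonnegative, even, smooth functions supported in the open unit ball with
integral one. -/
def memF (f : ℝ → ℝ) : Prop :=
  (∀ x, 0 ≤ f x) ∧ (∀ x, f (-x) = f x) ∧ ContDiff ℝ (⊤ : ℕ∞) f ∧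
    Function.support f ⊆ Metric.ball (0 : ℝ) 1 ∧ (∫ x, f x) = 1

/-- The Fourier transform `ĝ(x) = ∫ e^{ixz} g(z) dz`. -/
noncomputable def ft (g : ℝ → ℂ) (x : ℝ) : ℂ :=
  ∫ z : ℝ, Complex.exp (Complex.I * x * z) * g z

lemma integrable_truncated_abs_rpow {a : ℝ} (ha : a < 1) :
    Integrable (fun y : ℝ => if |y| ≤ 1 / 2 then |y| ^ (-a) else 0) := by
  have h := integrable_fun_norm_addHaar (E := ℝ) (F := ℝ) volume
    (f := fun t : ℝ => if t ≤ 1 / 2 then t ^ (-a) else 0)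
  simp only [Real.norm_eq_abs] at h
  rw [h]
  simp only [Module.finrank_self, Nat.sub_self, pow_zero, one_smul]
  have h1 : IntegrableOn (fun x : ℝ => x ^ (-a)) (Ioc 0 (1 / 2)) :=
    (intervalIntegrable_iff_integrableOn_Ioc_of_le (by norm_num)).1
      (intervalIntegral.intervalIntegrable_rpow' (by linarith))
  have h2 : (fun t : ℝ => if t ≤ 1 / 2 then t ^ (-a) else 0) =
      (Iic (1 / 2 : ℝ)).indicator (fun t => t ^ (-a)) := by
    ext t; simp [indicator]
  rw [h2, integrableOn_indicator_iff measurableSet_Iic, inter_comm, Ioi_inter_Iic]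
  exact h1

lemma abs_rpow_mul_abs_one_sub_rpow_le {a b : ℝ} (ha : 0 < a) (hb : 0 < b) (y : ℝ) :
    |y| ^ (-a) * |1 - y| ^ (-b) ≤
      2 ^ b * (if |y| ≤ 1 / 2 then |y| ^ (-a) else 0) +
      2 ^ a * (if |1 - y| ≤ 1 / 2 then |1 - y| ^ (-b) else 0) +
      3 ^ a * 5 ^ b * (1 + |y|) ^ (-(a + b)) := by
  have key : ∀ {c s t : ℝ}, 0 < c → 0 < s → 0 < t → ∀ {r : ℝ}, 0 < r → t ≤ r * s →
      s ^ (-c) ≤ r ^ c * t ^ (-c) := by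
    intro c s t hc hs ht r hr hle
    rw [Real.rpow_neg hs.le, Real.rpow_neg ht.le, ← div_eq_mul_inv, inv_eq_one_div,
      div_le_div_iff₀ (by positivity) (by positivity), one_mul, ← Real.mul_rpow hr.le hs.le]
    exact Real.rpow_le_rpow ht.le hle hc.le
  have tri : 1 ≤ |y| + |1 - y| := by
    have := abs_add_le y (1 - y)
    simpa using this
  have tri' : |y| ≤ |1 - y| + 1 := by
    have := abs_sub_abs_le_abs_sub y 1
    rw [abs_sub_comm y 1, abs_one] at this
    linarith
  have n1 : 0 ≤ |y| ^ (-a) := by positivity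
  have n2 : 0 ≤ |1 - y| ^ (-b) := by positivity
  have n3 : 0 ≤ (3 : ℝ) ^ a * 5 ^ b * (1 + |y|) ^ (-(a + b)) := by positivity
  have p1 : 0 ≤ 2 ^ b * (if |y| ≤ 1 / 2 then |y| ^ (-a) else 0) := by positivity
  have p2 : 0 ≤ 2 ^ a * (if |1 - y| ≤ 1 / 2 then |1 - y| ^ (-b) else 0) := by positivity
  by_cases h1 : |y| ≤ 1 / 2
  · have h2 := key (t := 1) hb (by linarith : 0 < |1 - y|) one_pos (r := 2) two_pos (by linarith)
    rw [Real.one_rpow, mul_one] at h2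
    rw [if_pos h1]
    nlinarith [mul_le_mul_of_nonneg_left h2 n1]
  by_cases h2 : |1 - y| ≤ 1 / 2
  · push Not at h1
    have h3 := key (t := 1) ha (by linarith : 0 < |y|) one_pos (r := 2) two_pos (by linarith)
    rw [Real.one_rpow, mul_one] at h3
    rw [if_pos h2]
    nlinarith [mul_le_mul_of_nonneg_right h3 n2]
  · push Not at h1 h2
    have h3 := key (t := 1 + |y|) ha (by linarith : 0 < |y|) (by linarith) (r := 3)
      (by norm_num) (by linarith)
    have h4 := key (c := b) (s := |1 - y|) (t := 1 + |y|) (r := 5) hb (by linarith) (by linarith)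
      (by norm_num) (by linarith)
    have h5 := mul_le_mul h3 h4 n2 (by positivity)
    have h6 : (1 + |y|) ^ (-(a + b)) = (1 + |y|) ^ (-a) * (1 + |y|) ^ (-b) := by
      rw [neg_add, Real.rpow_add (by positivity)]
    rw [h6]
    rw [h6] at n3
    linarith

lemma integrable_abs_rpow_mul_abs_one_sub_rpow {a b : ℝ} (ha : 0 < a) (ha1 : a < 1) (hb : 0 < b)
    (hb1 : b < 1) (hab : 1 < a + b) :
    Integrable (fun y : ℝ => |y| ^ (-a) * |1 - y| ^ (-b)) := by
  have i3 : Integrable (fun y : ℝ => (1 + |y|) ^ (-(a + b))) := by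
    have := integrable_one_add_norm (E := ℝ) (μ := volume) (r := a + b) (by simpa using hab)
    simpa using this
  have i2 := (integrable_truncated_abs_rpow hb1).comp_sub_left 1
  have i := (((integrable_truncated_abs_rpow ha1).const_mul (2 ^ b)).add
    (i2.const_mul (2 ^ a))).add (i3.const_mul (3 ^ a * 5 ^ b))
  refine i.mono' (Measurable.aestronglyMeasurable (by fun_prop)) (ae_of_all _ fun y => ?_)
  rw [Real.norm_of_nonneg (by positivity)]
  exact abs_rpow_mul_abs_one_sub_rpow_le ha hb y

lemma integrable_inv_one_add_sq_mul_abs_rpow {b : ℝ} (hb : 0 < b) (hb1 : b < 1) :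
    Integrable (fun s : ℝ => (1 + s ^ 2)⁻¹ * |s| ^ (-b)) := by
  have i := (integrable_truncated_abs_rpow hb1).add (integrable_inv_one_add_sq.const_mul (2 ^ b))
  refine i.mono' (Measurable.aestronglyMeasurable (by fun_prop)) (ae_of_all _ fun s => ?_)
  rw [Real.norm_of_nonneg (by positivity)]
  have n1 : 0 ≤ |s| ^ (-b) := by positivity
  have n2 : 0 < (1 + s ^ 2)⁻¹ := by positivity
  have n3 : (1 + s ^ 2)⁻¹ ≤ 1 := inv_le_one_of_one_le₀ (by nlinarith)
  simp only [Pi.add_apply]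
  by_cases h : |s| ≤ 1 / 2
  · rw [if_pos h]
    have : 0 ≤ 2 ^ b * (1 + s ^ 2)⁻¹ := by positivity
    nlinarith
  · rw [if_neg h, zero_add, mul_comm]
    push Not at h
    refine mul_le_mul_of_nonneg_right ?_ n2.le
    rw [Real.rpow_neg (by positivity), ← Real.inv_rpow (by positivity)]
    refine Real.rpow_le_rpow (by positivity) ?_ hb.le
    rw [inv_le_comm₀ (by linarith) two_pos]
    linarith

lemma lintegral_abs_rpow_mul_abs_sub_rpow (a b : ℝ) {u : ℝ} (hu : u ≠ 0) :
    ∫⁻ x : ℝ, ENNReal.ofReal (|x| ^ (-a)) * ENNReal.ofReal (|u - x| ^ (-b)) =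
      (∫⁻ y : ℝ, ENNReal.ofReal (|y| ^ (-a) * |1 - y| ^ (-b))) *
        ENNReal.ofReal (|u| ^ (1 - a - b)) := by
  have hu' : 0 < |u| := abs_pos.2 hu
  conv_lhs => rw [← Real.smul_map_volume_mul_left hu]
  rw [lintegral_smul_measure, lintegral_map (by fun_prop) (by fun_prop), smul_eq_mul,
    ← lintegral_const_mul _ (by fun_prop), ← lintegral_mul_const _ (by fun_prop)]
  refine lintegral_congr fun y => ?_
  rw [← ENNReal.ofReal_mul (by positivity), ← ENNReal.ofReal_mul (by positivity),
    ← ENNReal.ofReal_mul (by positivity)]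
  congr 1
  rw [show u - u * y = u * (1 - y) by ring, abs_mul, abs_mul, Real.mul_rpow hu'.le (abs_nonneg _),
    Real.mul_rpow hu'.le (abs_nonneg _), show 1 - a - b = 1 + -a + -b by ring,
    Real.rpow_add hu', Real.rpow_add hu', Real.rpow_one]
  ring

lemma lintegral_comp_sum_mul_prod_le {α : ℝ} (hα : α < 1) (n : ℕ) (hn : (n + 1) * (1 - α) < 1) :
    ∃ C : ℝ≥0∞, C ≠ ∞ ∧ ∀ g : ℝ → ℝ≥0∞, Measurable g →
      ∫⁻ x : Fin (n + 1) → ℝ, g (∑ i, x i) * ∏ i, ENNReal.ofReal (|x i| ^ (-α)) ≤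
        C * ∫⁻ s : ℝ, g s * ENNReal.ofReal (|s| ^ (-(1 - (n + 1) * (1 - α)))) := by
  induction n with
  | zero =>
    refine ⟨1, ENNReal.one_ne_top, fun g hg => ?_⟩
    rw [← (volume_preserving_funUnique (Fin 1) ℝ).lintegral_comp_emb
      (MeasurableEquiv.measurableEmbedding _)]
    simp
    refine le_of_eq ?_
    congr!
  | succ n ih =>
    push_cast at hn ⊢
    obtain ⟨C, hC, ih⟩ := ih (by nlinarith)
    set b : ℝ := 1 - (n + 1) * (1 - α) with hb
    have hn0 : (0 : ℝ) ≤ n := n.cast_nonneg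
    have hα' : 0 < α := by nlinarith
    have hB := (integrable_abs_rpow_mul_abs_one_sub_rpow (a := α) (b := b) hα' hα
      (by nlinarith) (by nlinarith) (by nlinarith)).lintegral_lt_top
    refine ⟨C * ∫⁻ y : ℝ, ENNReal.ofReal (|y| ^ (-α) * |1 - y| ^ (-b)),
      ENNReal.mul_ne_top hC hB.ne, fun g hg => ?_⟩
    calc ∫⁻ x : Fin (n + 1 + 1) → ℝ, g (∑ i, x i) * ∏ i, ENNReal.ofReal (|x i| ^ (-α))
        = ∫⁻ p : ℝ × (Fin (n + 1) → ℝ), g (p.1 + ∑ i, p.2 i) *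
            (ENNReal.ofReal (|p.1| ^ (-α)) * ∏ i, ENNReal.ofReal (|p.2 i| ^ (-α))) := by
          rw [← (volume_preserving_piFinSuccAbove (fun _ : Fin (n + 1 + 1) => ℝ)
            0).lintegral_comp_emb (MeasurableEquiv.measurableEmbedding _)]
          refine lintegral_congr fun x => ?_
          rw [Fin.sum_univ_succ, Fin.prod_univ_succ]
          rfl
      _ = ∫⁻ t : ℝ, ENNReal.ofReal (|t| ^ (-α)) * ∫⁻ x : Fin (n + 1) → ℝ, g (t + ∑ i, x i) *
            ∏ i, ENNReal.ofReal (|x i| ^ (-α)) := by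
          rw [Measure.volume_eq_prod, lintegral_prod _ (by fun_prop)]
          refine lintegral_congr fun t => ?_
          rw [← lintegral_const_mul _ (by fun_prop)]
          refine lintegral_congr fun x => ?_
          simp only
          ring
      _ ≤ ∫⁻ t : ℝ, ENNReal.ofReal (|t| ^ (-α)) * (C * ∫⁻ s : ℝ, g (t + s) *
            ENNReal.ofReal (|s| ^ (-b))) := by
          gcongr with t
          exact ih (fun s => g (t + s)) (by fun_prop)
      _ = ∫⁻ t : ℝ, ∫⁻ u : ℝ, C * (g u * (ENNReal.ofReal (|t| ^ (-α)) *
            ENNReal.ofReal (|u - t| ^ (-b)))) := by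
          refine lintegral_congr fun t => ?_
          rw [← lintegral_sub_right_eq_self _ t, ← lintegral_const_mul _ (by fun_prop),
            ← lintegral_const_mul _ (by fun_prop)]
          refine lintegral_congr fun u => ?_
          rw [add_sub_cancel]
          ring
      _ = ∫⁻ u : ℝ, C * (g u * ∫⁻ t : ℝ, ENNReal.ofReal (|t| ^ (-α)) *
            ENNReal.ofReal (|u - t| ^ (-b))) := by
          rw [lintegral_lintegral_swap (by fun_prop)]
          refine lintegral_congr fun u => ?_
          rw [lintegral_const_mul _ (by fun_prop), lintegral_const_mul _ (by fun_prop)]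
      _ = _ := by
          rw [← lintegral_const_mul _ (by fun_prop)]
          refine lintegral_congr_ae ?_
          filter_upwards [compl_mem_ae_iff.2 (measure_singleton (μ := volume) (0 : ℝ))] with u hu
          rw [lintegral_abs_rpow_mul_abs_sub_rpow α b hu,
            show 1 - α - b = -(1 - ((n : ℝ) + 1 + 1) * (1 - α)) by rw [hb]; ring]
          ring
      _ ≤ _ := le_rfl

lemma ft_continuous {g : ℝ → ℂ} (hg : Integrable g) : Continuous (ft g) := by
  refine continuous_of_dominated (bound := fun z => ‖g z‖) (fun x => ?_) (fun x => ?_) hg.norm ?_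
  · exact (Continuous.aestronglyMeasurable (by fun_prop)).mul hg.aestronglyMeasurable
  · refine ae_of_all _ fun z => ?_
    rw [norm_mul, mul_assoc, ← Complex.ofReal_mul, Complex.norm_exp_I_mul_ofReal, one_mul]
  · exact ae_of_all _ fun z => by fun_prop

lemma norm_ft_le (g : ℝ → ℂ) (x : ℝ) : ‖ft g x‖ ≤ ∫ z, ‖g z‖ := by
  refine (norm_integral_le_integral_norm _).trans_eq (integral_congr_ae (ae_of_all _ fun z => ?_))
  simp only
  rw [norm_mul, mul_assoc, ← Complex.ofReal_mul, Complex.norm_exp_I_mul_ofReal, one_mul]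

lemma integrable_indicator_of_ordConnected {I : Set ℝ} (hI : I.OrdConnected)
    (hb : Bornology.IsBounded I) : Integrable (I.indicator (fun _ => (1 : ℂ))) := by
  rw [integrable_indicator_iff hI.measurableSet]
  exact integrableOn_const hb.measure_lt_top.ne

lemma norm_mul_ft_indicator_le {I : Set ℝ} (hI : I.OrdConnected)
    (hb : Bornology.IsBounded I) (x : ℝ) :
    |x| * ‖ft (I.indicator (fun _ => (1 : ℂ))) x‖ ≤ 2 := by
  rcases eq_or_ne x 0 with rfl | hx
  · simp
  rcases I.eq_empty_or_nonempty with rfl | hne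
  · simp [ft]
  have hIoo := IsConnected.Ioo_csInf_csSup_subset ⟨hne, hI.isPreconnected⟩ hb.bddBelow hb.bddAbove
  have hIcc := subset_Icc_csInf_csSup hb.bddBelow hb.bddAbove
  have hle : sInf I ≤ sSup I := Real.sInf_le_sSup I hb.bddBelow hb.bddAbove
  have hae : I =ᵐ[volume] Ioc (sInf I) (sSup I) := by
    refine (Filter.EventuallyLE.antisymm ?_ ?_)
    · exact (LE.le.eventuallyLE hIcc).trans Ioc_ae_eq_Icc.symm.le
    · exact Ioo_ae_eq_Ioc.symm.le.trans (LE.le.eventuallyLE hIoo)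
  have hc : Complex.I * x ≠ 0 := mul_ne_zero Complex.I_ne_zero (by exact_mod_cast hx)
  have h1 : ft (I.indicator (fun _ => (1 : ℂ))) x =
      (Complex.exp (Complex.I * x * (sSup I : ℝ)) - Complex.exp (Complex.I * x * (sInf I : ℝ))) /
        (Complex.I * x) := by
    rw [← integral_exp_mul_complex hc, intervalIntegral.integral_of_le hle,
      ← setIntegral_congr_set hae, ← integral_indicator hI.measurableSet, ft]
    refine integral_congr_ae (ae_of_all _ fun z => ?_)
    by_cases hz : z ∈ I <;> simp [hz]
  rw [h1, norm_div, norm_mul, Complex.norm_I, one_mul, Complex.norm_real, Real.norm_eq_abs,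
    mul_div_cancel₀ _ (abs_ne_zero.2 hx)]
  refine (norm_sub_le _ _).trans_eq ?_
  rw [mul_assoc, mul_assoc, ← Complex.ofReal_mul, ← Complex.ofReal_mul,
    Complex.norm_exp_I_mul_ofReal, Complex.norm_exp_I_mul_ofReal]
  norm_num

lemma memA.ofReal_eq_sum {m : ℕ} {a : Fin m → ℝ} {I : Fin m → Set ℝ} {ψ : ℝ → ℝ}
    (hψ : ∀ x, ψ x = ∑ j, a j * (I j).indicator (fun _ => (1 : ℝ)) x) :
    (fun z => (ψ z : ℂ)) = fun z => ∑ j, (a j : ℂ) * (I j).indicator (fun _ => (1 : ℂ)) z := by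
  ext z
  rw [hψ]
  push_cast
  refine Finset.sum_congr rfl fun j _ => ?_
  by_cases hz : z ∈ I j <;> simp [hz]

lemma memA.integrable {ψ : ℝ → ℝ} (hψ : memA ψ) : Integrable (fun z => (ψ z : ℂ)) := by
  obtain ⟨m, a, I, hI, hψ⟩ := hψ
  rw [memA.ofReal_eq_sum hψ]
  exact integrable_finsetSum _ fun j _ =>
    (integrable_indicator_of_ordConnected (hI j).1 (hI j).2).const_mul _

lemma memA.exists_norm_ft_sq_le {ψ : ℝ → ℝ} (hψ : memA ψ) :
    ∃ C : ℝ, 0 ≤ C ∧ ∀ x, ‖ft (fun z => (ψ z : ℂ)) x‖ ^ 2 ≤ C * (1 + x ^ 2)⁻¹ := by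
  have hbd := norm_ft_le (fun z => (ψ z : ℂ))
  have hdecay : ∃ B, ∀ x, |x| * ‖ft (fun z => (ψ z : ℂ)) x‖ ≤ B := by
    obtain ⟨m, a, I, hI, hψ⟩ := hψ
    refine ⟨∑ j, |a j| * 2, fun x => ?_⟩
    have hsum : ft (fun z => (ψ z : ℂ)) x =
        ∑ j, (a j : ℂ) * ft ((I j).indicator (fun _ => (1 : ℂ))) x := by
      rw [memA.ofReal_eq_sum hψ]
      simp only [ft, Finset.mul_sum]
      rw [integral_finsetSum]
      · refine Finset.sum_congr rfl fun j _ => ?_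
        rw [← integral_const_mul]
        refine integral_congr_ae (ae_of_all _ fun z => ?_)
        simp only
        ring
      · intro j _
        refine ((integrable_indicator_of_ordConnected (hI j).1 (hI j).2).const_mul
          (a j : ℂ)).bdd_mul (c := 1) (Continuous.aestronglyMeasurable (by fun_prop))
            (ae_of_all _ fun z => ?_)
        rw [mul_assoc, ← Complex.ofReal_mul, Complex.norm_exp_I_mul_ofReal]
    rw [hsum]
    calc _ ≤ |x| * ∑ j, ‖(a j : ℂ) * ft ((I j).indicator (fun _ => (1 : ℂ))) x‖ := by
          gcongr
          exact norm_sum_le _ _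
      _ = ∑ j, |a j| * (|x| * ‖ft ((I j).indicator (fun _ => (1 : ℂ))) x‖) := by
          rw [Finset.mul_sum]
          refine Finset.sum_congr rfl fun j _ => ?_
          rw [norm_mul, Complex.norm_real, Real.norm_eq_abs]
          ring
      _ ≤ _ := by
          gcongr with j
          exact norm_mul_ft_indicator_le (hI j).1 (hI j).2 x
  obtain ⟨B, hB⟩ := hdecay
  refine ⟨(∫ z, ‖(ψ z : ℂ)‖) ^ 2 + B ^ 2, by positivity, fun x => ?_⟩
  rw [← div_eq_mul_inv, le_div_iff₀ (by positivity)]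
  have h1 := pow_le_pow_left₀ (norm_nonneg _) (hbd x) 2
  have h2 := pow_le_pow_left₀ (by positivity) (hB x) 2
  rw [mul_pow, sq_abs] at h2
  linarith

lemma memF.integrable {f : ℝ → ℝ} (hf : memF f) : Integrable (fun z => (f z : ℂ)) := by
  refine Integrable.ofReal ?_
  by_contra h
  exact zero_ne_one ((integral_undef h).symm.trans hf.2.2.2.2)

lemma memF.norm_ft_le_one {f : ℝ → ℝ} (hf : memF f) (x : ℝ) :
    ‖ft (fun z => (f z : ℂ)) x‖ ≤ 1 := by
  refine (norm_ft_le _ x).trans_eq ?_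
  rw [← hf.2.2.2.2]
  refine integral_congr_ae (ae_of_all _ fun z => ?_)
  simp [abs_of_nonneg (hf.1 z)]

lemma memF.ft_zero {f : ℝ → ℝ} (hf : memF f) : ft (fun z => (f z : ℂ)) 0 = 1 := by
  simp only [ft, Complex.ofReal_zero, mul_zero, zero_mul, Complex.exp_zero, one_mul]
  rw [integral_complex_ofReal, hf.2.2.2.2, Complex.ofReal_one]

lemma memA.lintegral_norm_ft_sq_mul_prod_ne_top {ψ : ℝ → ℝ} (hψ : memA ψ) {k : ℕ} (hk : 2 ≤ k)
    {α : ℝ} (hα : α ∈ Set.Ioo (1 - 1 / (k : ℝ)) 1) :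
    ∫⁻ x : Fin k → ℝ, ENNReal.ofReal
      (‖ft (fun z => (ψ z : ℂ)) (∑ i, x i)‖ ^ 2 * 4 * ∏ i, |x i| ^ (-α)) ≠ ∞ := by
  obtain ⟨C, hC, hψC⟩ := hψ.exists_norm_ft_sq_le
  obtain ⟨n, rfl⟩ : ∃ n, k = n + 1 := ⟨k - 1, by omega⟩
  have hn0 : (0 : ℝ) ≤ n := n.cast_nonneg
  have hn : ((n : ℝ) + 1) * (1 - α) < 1 := by
    have h := hα.1
    push_cast at h
    have h2 : 1 - α < 1 / ((n : ℝ) + 1) := by linarith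
    rw [lt_div_iff₀ (by positivity)] at h2
    linarith
  obtain ⟨D, hD, hle⟩ := lintegral_comp_sum_mul_prod_le hα.2 n hn
  have hfin := (integrable_inv_one_add_sq_mul_abs_rpow
    (b := 1 - ((n : ℝ) + 1) * (1 - α)) (by linarith)
    (by nlinarith [hα.2])).lintegral_lt_top
  have hG := hle (fun s => ENNReal.ofReal ((C * 4) * (1 + s ^ 2)⁻¹)) (by fun_prop)
  refine ne_top_of_le_ne_top ?_ (le_trans (lintegral_mono fun x => ?_) hG)
  · refine ENNReal.mul_ne_top hD ?_
    simp only [ENNReal.ofReal_mul (show 0 ≤ C * 4 by positivity)]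
    simp only [mul_assoc (ENNReal.ofReal (C * 4))]
    rw [lintegral_const_mul _ (by fun_prop)]
    refine ENNReal.mul_ne_top ENNReal.ofReal_ne_top ?_
    refine ne_of_eq_of_ne (lintegral_congr fun s => ?_) hfin.ne
    rw [ENNReal.ofReal_mul (by positivity)]
  · simp only
    rw [← ENNReal.ofReal_prod_of_nonneg (fun i _ => by positivity),
      ← ENNReal.ofReal_mul (by positivity)]
    refine ENNReal.ofReal_le_ofReal ?_
    refine mul_le_mul_of_nonneg_right ?_ (Finset.prod_nonneg fun i _ => by positivity)
    linarith [hψC (∑ i, x i)]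

theorem stmt13 (k : ℕ) (hk : 2 ≤ k) (α : ℝ) (hα : α ∈ Set.Ioo (1 - 1 / (k : ℝ)) 1)
    (ψ : ℝ → ℝ) (hψ : memA ψ) (f : ℝ → ℝ) (hf : memF f) :
    Tendsto
      (fun ε : ℝ =>
        ∫⁻ x : Fin k → ℝ,
          ENNReal.ofReal
            (‖ft (fun z => (ψ z : ℂ)) (∑ i, x i)‖ ^ 2 *
              ‖ft (fun z => (f z : ℂ)) (ε * ∑ i, x i) - 1‖ ^ 2 * ∏ i, |x i| ^ (-α)))
      (nhdsWithin 0 (Set.Ioi 0)) (nhds 0) := by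
  have cψ := ft_continuous hψ.integrable
  have cf := ft_continuous hf.integrable
  have mψ := cψ.measurable
  have mf := cf.measurable
  have h := tendsto_lintegral_filter_of_dominated_convergence (μ := volume)
    (l := nhdsWithin (0 : ℝ) (Set.Ioi 0)) (f := fun _ => 0)
    (F := fun (ε : ℝ) (x : Fin k → ℝ) => ENNReal.ofReal
            (‖ft (fun z => (ψ z : ℂ)) (∑ i, x i)‖ ^ 2 *
              ‖ft (fun z => (f z : ℂ)) (ε * ∑ i, x i) - 1‖ ^ 2 * ∏ i, |x i| ^ (-α)))
    _ (Eventually.of_forall fun ε => by fun_prop)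
    (Eventually.of_forall fun ε => ae_of_all _ fun x => ?_)
    (hψ.lintegral_norm_ft_sq_mul_prod_ne_top hk hα) (ae_of_all _ fun x => ?_)
  · simpa using h
  · refine ENNReal.ofReal_le_ofReal ?_
    refine mul_le_mul_of_nonneg_right ?_ (Finset.prod_nonneg fun i _ => by positivity)
    refine mul_le_mul_of_nonneg_left ?_ (by positivity)
    have h1 : ‖ft (fun z => (f z : ℂ)) (ε * ∑ i, x i) - 1‖ ≤ 2 := by
      refine (norm_sub_le _ _).trans ?_
      rw [norm_one]
      linarith [hf.norm_ft_le_one (ε * ∑ i, x i)]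
    nlinarith [norm_nonneg (ft (fun z => (f z : ℂ)) (ε * ∑ i, x i) - 1)]
  · refine Tendsto.mono_left ?_ nhdsWithin_le_nhds
    have hc : Continuous fun ε : ℝ => ENNReal.ofReal
            (‖ft (fun z => (ψ z : ℂ)) (∑ i, x i)‖ ^ 2 *
              ‖ft (fun z => (f z : ℂ)) (ε * ∑ i, x i) - 1‖ ^ 2 * ∏ i, |x i| ^ (-α)) :=
      ENNReal.continuous_ofReal.comp (by fun_prop)
    simpa [hf.ft_zero] using hc.tendsto 0
end
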